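/- Fix d ≥ 1 and k : Fin d → ℕ, let i be a natural number with i + 1 > k(0), and let a ∈ A^{i}(k) with a(0) < k(0) (so that a + ê₀ ∈ A^{i+1}(k)). Then the inequality is strict: J^{i+1}(a + ê₀) < J^{i}(a). (In particular there exists ξ ∈ A^{i}(k) with ξ(0) = k(0), hence ξ ><sub>lex</sub> a, for which ξ + ê₀ ∉ A^{i+1}(k).) -/

import Mathlib

open Finset


open Finset

/-- The level set `A^i(k)`: vectors `a : Fin d → ℕ` with `a j ≤ k j` for all `j`
and `∑ j, a j = i`. -/
def levelSet (d : ℕ) (k : Fin d → ℕ) (i : ℕ) : Finset (Fin d → ℕ) :=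
  (Fintype.piFinset fun j => Finset.range (k j + 1)).filter fun a => ∑ j, a j = i

/-- Lexicographic comparison from left to right: `x >_lex y` iff `x j > y j` at the
first index `j` where they differ. -/
def lexGT {d : ℕ} (x y : Fin d → ℕ) : Prop :=
  ∃ j : Fin d, (∀ j' : Fin d, j' < j → x j' = y j') ∧ y j < x j

/-- The unit vector `ê₀ = (1,0,…,0)`. -/
def unit0 (d : ℕ) : Fin d → ℕ := fun j => if (j : ℕ) = 0 then 1 else 0

open scoped Classical in
/-- The index of `a` in the reverse lexicographic ordering of `A^i(k)`:
the number of elements of `A^i(k)` lexicographically greater than `a`. -/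
noncomputable def lexIndex (d : ℕ) (k : Fin d → ℕ) (i : ℕ) (a : Fin d → ℕ) : ℕ :=
  ((levelSet d k i).filter fun x => lexGT x a).card

theorem mem_levelSet {d : ℕ} {k : Fin d → ℕ} {i : ℕ} {a : Fin d → ℕ} :
    a ∈ levelSet d k i ↔ (∀ j, a j ≤ k j) ∧ ∑ j, a j = i := by
  simp [levelSet]

theorem exists_le_sum_eq {ι : Type*} [Fintype ι] (b : ι → ℕ) (m : ℕ) (hm : m ≤ ∑ j, b j) :
    ∃ c ≤ b, ∑ j, c j = m := by
  classical
  induction m with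
  | zero => exact ⟨0, fun j => Nat.zero_le _, by simp⟩
  | succ m ih =>
    obtain ⟨c, hc, hsum⟩ := ih (by omega)
    obtain ⟨j, -, hj⟩ : ∃ j ∈ univ, c j < b j :=
      Finset.exists_lt_of_sum_lt (by omega)
    refine ⟨c + Pi.single j 1, fun l => ?_, ?_⟩
    · by_cases h : l = j
      · subst h
        simpa using hj
      · simpa [h] using hc l
    · simp [Finset.sum_add_distrib, hsum]

theorem sum_unit0 (n : ℕ) : ∑ j, unit0 (n + 1) j = 1 := by
  simp [unit0]

theorem unit0_zero (n : ℕ) : unit0 (n + 1) 0 = 1 := by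
  simp [unit0]

theorem lexGT_add_right_iff {d : ℕ} (x y z : Fin d → ℕ) :
    lexGT (x + z) (y + z) ↔ lexGT x y := by
  simp [lexGT]

theorem lexGT.zero_le {n : ℕ} {x y : Fin (n + 1) → ℕ} (h : lexGT x y) : y 0 ≤ x 0 := by
  obtain ⟨j, heq, hlt⟩ := h
  rcases Fin.eq_zero_or_eq_succ j with rfl | ⟨l, rfl⟩
  · exact hlt.le
  · exact (heq 0 (Fin.succ_pos l)).ge

theorem unit0_le {n : ℕ} {y : Fin (n + 1) → ℕ} (h : 1 ≤ y 0) : unit0 (n + 1) ≤ y := by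
  intro j
  cases j using Fin.cases with
  | zero => simpa [unit0] using h
  | succ l => simp [unit0]

/-- If `A^i(k)` is nonempty and `k 0 ≤ i`, then some element has first coordinate `k 0`. -/
theorem exists_mem_levelSet_zero_eq {n : ℕ} {k a : Fin (n + 1) → ℕ} {i : ℕ}
    (hik : k 0 ≤ i) (ha : a ∈ levelSet (n + 1) k i) :
    ∃ ξ ∈ levelSet (n + 1) k i, ξ 0 = k 0 := by
  obtain ⟨hak, hsum⟩ := mem_levelSet.1 ha
  rw [Fin.sum_univ_succ] at hsum
  have hak0 := hak 0
  obtain ⟨c, hc, hcs⟩ := exists_le_sum_eq (fun j : Fin n => a j.succ) (i - k 0) (by omega)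
  refine ⟨Fin.cons (k 0) c, mem_levelSet.2 ⟨fun j => ?_, ?_⟩, by simp⟩
  · cases j using Fin.cases with
    | zero => simp
    | succ l => simpa using (hc l).trans (hak l.succ)
  · rw [Fin.sum_univ_succ]
    simp [hcs, hik]

/-- If `i + 1 > k 0`, then for `a ∈ A^i(k)` with `a 0 < k 0` the inequality is strict:
`J^{i+1}(a + ê₀) < J^i(a)`. -/
theorem index_strict_inequality_large_i (d : ℕ) (hd : 1 ≤ d) (k : Fin d → ℕ) (i : ℕ)
    (hik : k ⟨0, hd⟩ < i + 1) (a : Fin d → ℕ) (ha : a ∈ levelSet d k i)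
    (ha0 : a ⟨0, hd⟩ < k ⟨0, hd⟩) :
    lexIndex d k (i + 1) (a + unit0 d) < lexIndex d k i a := by
  classical
  obtain ⟨n, rfl⟩ : ∃ n, d = n + 1 := ⟨d - 1, by omega⟩
  change k 0 < i + 1 at hik
  change a 0 < k 0 at ha0
  obtain ⟨ξ, hξ, hξ0⟩ := exists_mem_levelSet_zero_eq (by omega) ha
  have hξa : lexGT ξ a := ⟨0, fun j hj => absurd hj (Fin.not_lt_zero j), by omega⟩
  have hle : ∀ y, lexGT y (a + unit0 (n + 1)) → unit0 (n + 1) ≤ y := fun y hy => by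
    have h := hy.zero_le
    rw [Pi.add_apply, unit0_zero] at h
    exact unit0_le (by omega)
  unfold lexIndex
  refine lt_of_le_of_lt (Finset.card_le_card_of_injOn (fun y => y - unit0 (n + 1)) ?_ ?_)
    (Finset.card_erase_lt_of_mem (Finset.mem_filter.2 ⟨hξ, hξa⟩))
  · intro y hy
    obtain ⟨hyk, hya⟩ := Finset.mem_filter.1 hy
    obtain ⟨x, rfl⟩ : ∃ x, y = x + unit0 (n + 1) :=
      ⟨y - unit0 (n + 1), (tsub_add_cancel_of_le (hle y hya)).symm⟩
    obtain ⟨hxk, hxs⟩ := mem_levelSet.1 hyk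
    simp only [Pi.add_apply, Finset.sum_add_distrib, sum_unit0] at hxk hxs
    simp only [add_tsub_cancel_right, Finset.coe_erase, Set.mem_sdiff, Set.mem_singleton_iff,
      Finset.mem_coe, Finset.mem_filter]
    refine ⟨⟨mem_levelSet.2 ⟨fun j => le_of_add_le_left (hxk j), by omega⟩,
      (lexGT_add_right_iff _ _ _).1 hya⟩, ?_⟩
    rintro rfl
    have h0 := hxk 0
    rw [unit0_zero] at h0
    omega
  · intro x hx y hy hxy
    exact (tsub_left_inj (hle x (Finset.mem_filter.1 hx).2) (hle y (Finset.mem_filter.1 hy).2)).1 hxy
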